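/- Let p be a prime and A a separable abelian p-group (⋂ₙ pⁿA = 0). Then there exists a separable abelian p-group K such that the group G = A ⊕ K is separable, has minimal characteristic inertia, and has minimal full inertia; in particular, every separable abelian p-group is a direct summand of a separable abelian p-group having both minimal characteristic inertia and minimal full inertia. -/

import Mathlib

section Defs

variable {G : Type*} [AddCommGroup G]

/-- For a subgroup `X` of `G` and an endomorphism `φ` of `G`, `hatImage X φ` is the image
of `φ(X)` in the quotient `G ⧸ X`, i.e. the subgroup `(φ(X) + X)/X`. -/
def hatImage (X : AddSubgroup G) (φ : G →+ G) : AddSubgroup (G ⧸ X) :=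
  (AddSubgroup.map φ X).map (QuotientAddGroup.mk' X)

/-- `X` is fully invariant: stable under every additive endomorphism of `G`. -/
def FullyInvariantSub (X : AddSubgroup G) : Prop :=
  ∀ φ : G →+ G, AddSubgroup.map φ X ≤ X

/-- `X` is characteristic: stable under every additive automorphism of `G`. -/
def CharacteristicSub (X : AddSubgroup G) : Prop :=
  ∀ φ : G ≃+ G, AddSubgroup.map φ.toAddMonoidHom X ≤ X

/-- `X` is fully inert: `φ̂(X)` is finite for every endomorphism `φ` of `G`. -/
def FullyInertSub (X : AddSubgroup G) : Prop :=
  ∀ φ : G →+ G, Finite (hatImage X φ)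

/-- `X` is characteristically inert: `φ̂(X)` is finite for every automorphism `φ` of `G`. -/
def CharInertSub (X : AddSubgroup G) : Prop :=
  ∀ φ : G ≃+ G, Finite (hatImage X φ.toAddMonoidHom)

/-- Two subgroups are commensurable if their intersection has finite index in each of them. -/
def Commens (X Y : AddSubgroup G) : Prop :=
  ((X ⊓ Y).addSubgroupOf X).index ≠ 0 ∧ ((X ⊓ Y).addSubgroupOf Y).index ≠ 0

/-- `G` has minimal full inertia: every fully inert subgroup is commensurable with a
fully invariant subgroup. -/
def MinFullInertia (G : Type*) [AddCommGroup G] : Prop :=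
  ∀ X : AddSubgroup G, FullyInertSub X → ∃ Y : AddSubgroup G, FullyInvariantSub Y ∧ Commens X Y

/-- `G` has minimal characteristic inertia: every characteristically inert subgroup is
commensurable with a characteristic subgroup. -/
def MinCharInertia (G : Type*) [AddCommGroup G] : Prop :=
  ∀ X : AddSubgroup G, CharInertSub X → ∃ Y : AddSubgroup G, CharacteristicSub Y ∧ Commens X Y

/-- `G` is a `p`-group: every element is killed by some power of `p`. -/
def IsPGroup' (p : ℕ) (G : Type*) [AddCommGroup G] : Prop :=
  ∀ x : G, ∃ n : ℕ, p ^ n • x = 0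

/-- Multiplication by `m` as an additive endomorphism of `G`. -/
def smulHom (m : ℕ) : G →+ G where
  toFun x := m • x
  map_zero' := smul_zero m
  map_add' a b := smul_add m a b

/-- The subgroup `pⁿG`. -/
def pPowSub (p n : ℕ) : AddSubgroup G :=
  AddSubgroup.map (smulHom (p ^ n)) ⊤

/-- The subgroup `B[m] = {x ∈ B : m • x = 0}`. -/
def torSub (m : ℕ) (B : AddSubgroup G) : AddSubgroup G :=
  B ⊓ (smulHom m).ker

/-- The subgroup `mB = {m • x : x ∈ B}`. -/
def smulSub (m : ℕ) (B : AddSubgroup G) : AddSubgroup G :=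
  AddSubgroup.map (smulHom m) B

/-- The `p`-height of `x` in `G`: the supremum in `ℕ∞` of the set of `n` with `x ∈ pⁿG`. -/
noncomputable def pHeight (p : ℕ) (x : G) : ℕ∞ :=
  ⨆ n ∈ {n : ℕ | x ∈ (pPowSub p n : AddSubgroup G)}, (n : ℕ∞)

/-- `G` is transitive: any two elements with identical height sequences are connected by
an automorphism. -/
def TransitiveP (p : ℕ) (G : Type*) [AddCommGroup G] : Prop :=
  ∀ x y : G, (∀ n : ℕ, pHeight p (p ^ n • x) = pHeight p (p ^ n • y)) →
    ∃ φ : G ≃+ G, φ x = y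

/-- `G` is separable: `p^ω G = ⋂ₙ pⁿG = 0`. -/
def SeparableP (p : ℕ) (G : Type*) [AddCommGroup G] : Prop :=
  (⨅ n : ℕ, (pPowSub p n : AddSubgroup G)) = ⊥

end Defs

section Aux

open AddSubgroup

section General

variable {G : Type*} [AddCommGroup G]

lemma finite_hatImage_iff (X : AddSubgroup G) (φ : G →+ G) :
    Finite (hatImage X φ) ↔ X.relIndex (X.map φ) ≠ 0 := by
  have h := AddSubgroup.relIndex_ker (K := X.map φ) (QuotientAddGroup.mk' X)
  rw [QuotientAddGroup.ker_mk'] at h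
  rw [h]
  unfold hatImage
  constructor
  · intro h1
    exact Nat.card_pos.ne'
  · intro h1
    exact Nat.finite_of_card_ne_zero h1

lemma commens_iff (X Y : AddSubgroup G) :
    Commens X Y ↔ Y.relIndex X ≠ 0 ∧ X.relIndex Y ≠ 0 := by
  unfold Commens
  change (X ⊓ Y).relIndex X ≠ 0 ∧ (X ⊓ Y).relIndex Y ≠ 0 ↔ _
  rw [AddSubgroup.inf_relIndex_left, AddSubgroup.inf_relIndex_right]

/-- The images of subgroups of finite relative index again have finite relative index. -/
lemma relIndex_map_ne_zero {H : Type*} [AddCommGroup H] (f : G →+ H) {X Y : AddSubgroup G}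
    (h : X.relIndex Y ≠ 0) : (X.map f).relIndex (Y.map f) ≠ 0 := by
  rw [AddSubgroup.relIndex_map_map]
  have h1 : (X ⊔ f.ker).relIndex Y ≠ 0 := fun h0 =>
    h (AddSubgroup.relIndex_eq_zero_of_le_left le_sup_left h0)
  have h2 : (X ⊔ f.ker).relIndex (Y ⊔ (X ⊔ f.ker)) ≠ 0 := by
    rwa [AddSubgroup.relIndex_sup_right]
  intro h0
  exact h2 (AddSubgroup.relIndex_eq_zero_of_le_right
    (sup_le_sup_left le_sup_right Y) h0)

lemma relIndex_sup_le (X U V : AddSubgroup G) (hU : X.relIndex U ≠ 0) (hV : X.relIndex V ≠ 0) :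
    X.relIndex (U ⊔ V) ≠ 0 ∧ X.relIndex (U ⊔ V) ≤ X.relIndex U * X.relIndex V := by
  have e1 : X.relIndex (U ⊔ X) = X.relIndex U := AddSubgroup.relIndex_sup_right ..
  have e2 : (U ⊔ X).relIndex (V ⊔ (U ⊔ X)) = (U ⊔ X).relIndex V :=
    AddSubgroup.relIndex_sup_right ..
  have e3 : X.relIndex (U ⊔ X) * (U ⊔ X).relIndex (V ⊔ (U ⊔ X)) = X.relIndex (V ⊔ (U ⊔ X)) :=
    AddSubgroup.relIndex_mul_relIndex _ _ _ le_sup_right le_sup_right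
  have e4 : V ⊔ (U ⊔ X) = (U ⊔ V) ⊔ X := by
    rw [← sup_assoc, sup_comm V U]
  have e5 : X.relIndex ((U ⊔ V) ⊔ X) = X.relIndex (U ⊔ V) := AddSubgroup.relIndex_sup_right ..
  have h6 : (U ⊔ X).relIndex V ≤ X.relIndex V :=
    AddSubgroup.relIndex_le_of_le_left le_sup_right hV
  have h7 : (U ⊔ X).relIndex V ≠ 0 := fun h0 =>
    hV (AddSubgroup.relIndex_eq_zero_of_le_left le_sup_right h0)
  rw [e2, e4, e5, e1] at e3
  rw [← e3]
  exact ⟨mul_ne_zero hU h7, Nat.mul_le_mul_left _ h6⟩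

/-- `φ` moves `X` only finitely. -/
def Inr (X : AddSubgroup G) (φ : G →+ G) : Prop := X.relIndex (X.map φ) ≠ 0

lemma Inr.comp {X : AddSubgroup G} {φ ψ : G →+ G} (h1 : Inr X φ) (h2 : Inr X ψ) :
    Inr X (φ.comp ψ) := by
  unfold Inr at *
  rw [← AddSubgroup.map_map]
  exact AddSubgroup.relIndex_ne_zero_trans h1 (relIndex_map_ne_zero φ h2)

lemma map_add_le (X : AddSubgroup G) (φ ψ : G →+ G) : X.map (φ + ψ) ≤ X.map φ ⊔ X.map ψ := by
  rintro _ ⟨x, hx, rfl⟩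
  exact AddSubgroup.add_mem_sup ⟨x, hx, rfl⟩ ⟨x, hx, rfl⟩

lemma Inr.add {X : AddSubgroup G} {φ ψ : G →+ G} (h1 : Inr X φ) (h2 : Inr X ψ) :
    Inr X (φ + ψ) := fun h0 =>
  (relIndex_sup_le X _ _ h1 h2).1 (AddSubgroup.relIndex_eq_zero_of_le_right (map_add_le X φ ψ) h0)

lemma fullyInert_iff (X : AddSubgroup G) : FullyInertSub X ↔ ∀ φ, Inr X φ :=
  forall_congr' fun φ => finite_hatImage_iff X φ

lemma CharInertSub.inr_of_sq_zero {X : AddSubgroup G} (hX : CharInertSub X) (φ : G →+ G)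
    (h : ∀ x, φ (φ x) = 0) : Inr X φ := by
  let e : G ≃+ G :=
    { toFun := fun x => x + φ x
      invFun := fun x => x - φ x
      left_inv := fun x => by simp [h]
      right_inv := fun x => by simp [h]
      map_add' := fun x y => by simp only [map_add]; abel }
  have h1 : Inr X e.toAddMonoidHom := (finite_hatImage_iff X _).1 (hX e)
  have h2 : Inr X (-AddMonoidHom.id G) := by
    unfold Inr
    have : X.map (-AddMonoidHom.id G) ≤ X := by
      rintro _ ⟨x, hx, rfl⟩
      simpa using hx
    rw [AddSubgroup.relIndex_eq_one.2 this]
    exact one_ne_zero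
  have h3 := h1.add h2
  convert h3 using 1
  ext x
  simp [e]

/-- In a group of the form `H ⊕ H` characteristically inert subgroups are fully inert. -/
lemma CharInertSub.fullyInert {H : Type*} [AddCommGroup H] (e : G ≃+ H × H) {X : AddSubgroup G}
    (hX : CharInertSub X) : FullyInertSub X := by
  rw [fullyInert_iff]
  intro φ
  let a : G →+ H := (AddMonoidHom.fst H H).comp e.toAddMonoidHom
  let b : G →+ H := (AddMonoidHom.snd H H).comp e.toAddMonoidHom
  let i : H →+ G := e.symm.toAddMonoidHom.comp (AddMonoidHom.inl H H)
  let j : H →+ G := e.symm.toAddMonoidHom.comp (AddMonoidHom.inr H H)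
  have ai : ∀ x, a (i x) = x := fun x => by simp [a, i]
  have aj : ∀ x, a (j x) = 0 := fun x => by simp [a, j]
  have bi : ∀ x, b (i x) = 0 := fun x => by simp [b, i]
  have bj : ∀ x, b (j x) = x := fun x => by simp [b, j]
  have hs : ∀ x, i (a x) + j (b x) = x := fun x => by
    apply e.injective
    simp [a, b, i, j]
  have k1 : ∀ θ : H →+ H, Inr X (i.comp (θ.comp b)) := fun θ =>
    hX.inr_of_sq_zero _ fun x => by simp [bi]
  have k2 : ∀ θ : H →+ H, Inr X (j.comp (θ.comp a)) := fun θ =>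
    hX.inr_of_sq_zero _ fun x => by simp [aj]
  have k3 := ((k1 (a.comp (φ.comp j))).add (k2 (b.comp (φ.comp i)))).add
    (((k1 (AddMonoidHom.id H)).comp (k2 (a.comp (φ.comp i)))).add
      ((k2 (AddMonoidHom.id H)).comp (k1 (b.comp (φ.comp j)))))
  convert k3 using 1
  ext x
  simp only [AddMonoidHom.add_apply, AddMonoidHom.comp_apply, AddMonoidHom.id_apply, ai, bj]
  conv_lhs => rw [← hs x, map_add, ← hs (φ (i (a x))), ← hs (φ (j (b x)))]
  abel

lemma minChar_of_minFull {H : Type*} [AddCommGroup H] (e : G ≃+ H × H) (h : MinFullInertia G) :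
    MinCharInertia G := fun X hX => by
  obtain ⟨Y, hY, hXY⟩ := h X (hX.fullyInert e)
  exact ⟨Y, fun φ => hY φ.toAddMonoidHom, hXY⟩

lemma minFull_transport {G' : Type*} [AddCommGroup G'] (e : G ≃+ G') (h : MinFullInertia G') :
    MinFullInertia G := by
  intro X hX
  rw [fullyInert_iff] at hX
  have hX' : FullyInertSub (X.map e.toAddMonoidHom) := by
    rw [fullyInert_iff]
    intro φ
    have h1 := relIndex_map_ne_zero e.toAddMonoidHom
      (hX (e.symm.toAddMonoidHom.comp (φ.comp e.toAddMonoidHom)))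
    unfold Inr
    convert h1 using 2
    rw [AddSubgroup.map_map, AddSubgroup.map_map]
    congr 1
    ext x
    simp
  obtain ⟨Y, hY, hXY⟩ := h _ hX'
  rw [commens_iff] at hXY
  have hXe : (X.map e.toAddMonoidHom).map e.symm.toAddMonoidHom = X := by
    rw [AddSubgroup.map_map]
    convert AddSubgroup.map_id X
    ext x
    simp
  refine ⟨Y.map e.symm.toAddMonoidHom, ?_, ?_⟩
  · intro φ
    rintro _ ⟨_, ⟨y, hy, rfl⟩, rfl⟩
    refine ⟨e (φ (e.symm y)), ?_, by simp⟩
    exact hY (e.toAddMonoidHom.comp (φ.comp e.symm.toAddMonoidHom)) ⟨y, hy, rfl⟩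
  · rw [commens_iff]
    have h1 := relIndex_map_ne_zero e.symm.toAddMonoidHom hXY.1
    have h2 := relIndex_map_ne_zero e.symm.toAddMonoidHom hXY.2
    rw [hXe] at h1 h2
    exact ⟨h1, h2⟩

/-- The Bergman–Lenstra style argument: if `L` is a left ideal of endomorphisms moving `X`
uniformly boundedly, then some finite index subgroup `T` of `X` satisfies `L T ⊆ V` with
`V / X` finite. -/
lemma exists_core (X : AddSubgroup G) (L : AddSubgroup (G →+ G)) (N : ℕ)
    (hin : ∀ φ ∈ L, Inr X φ) (hN : ∀ φ ∈ L, X.relIndex (X.map φ) ≤ N) :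
    ∃ T V : AddSubgroup G, T ≤ X ∧ T.relIndex X ≠ 0 ∧ X.relIndex V ≠ 0 ∧
      ∀ φ ∈ L, T.map φ ≤ V := by
  classical
  have hex : ∃ m, ∃ T : AddSubgroup G, T ≤ X ∧ T.relIndex X ≠ 0 ∧
      ∀ φ ∈ L, X.relIndex (T.map φ) ≤ m :=
    ⟨N, X, le_rfl, by simp, hN⟩
  obtain ⟨T, hTX, hT, hm⟩ := Nat.find_spec hex
  have hmin := fun k => Nat.find_min hex (m := k)
  generalize Nat.find hex = m at hm hmin
  have hfin : ∀ S : AddSubgroup G, S ≤ X → ∀ φ ∈ L, X.relIndex (S.map φ) ≠ 0 :=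
    fun S hS φ hφ h0 => hin φ hφ (relIndex_eq_zero_of_le_right (AddSubgroup.map_mono hS) h0)
  -- every finite-index subgroup of `T` has an endomorphism attaining `m`
  have key : ∀ S : AddSubgroup G, S ≤ T → S.relIndex X ≠ 0 →
      ∃ φ ∈ L, m ≤ X.relIndex (S.map φ) := by
    intro S hST hS
    by_contra! hcon
    have hpos := hcon 0 L.zero_mem
    exact hmin (m - 1) (by omega) ⟨S, hST.trans hTX, hS, fun φ hφ => by
      have := hcon φ hφ
      omega⟩
  have eqq : ∀ U V : AddSubgroup G, U ≤ V ⊔ X → X.relIndex V ≠ 0 →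
      X.relIndex V ≤ X.relIndex U → V ≤ U ⊔ X := by
    intro U V hUV hV hle
    have h1 : X.relIndex (U ⊔ X) * (U ⊔ X).relIndex (V ⊔ X) = X.relIndex (V ⊔ X) :=
      relIndex_mul_relIndex _ _ _ le_sup_right (sup_le hUV le_sup_right)
    rw [relIndex_sup_right, relIndex_sup_right] at h1
    have h2 : (U ⊔ X).relIndex (V ⊔ X) = 1 := by
      have hV' : 0 < X.relIndex V := Nat.pos_of_ne_zero hV
      have : X.relIndex U ≠ 0 := by omega
      rcases Nat.lt_trichotomy ((U ⊔ X).relIndex (V ⊔ X)) 1 with h | h | h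
      · have h0 : (U ⊔ X).relIndex (V ⊔ X) = 0 := by omega
        rw [h0] at h1
        omega
      · exact h
      · nlinarith
    exact le_sup_left.trans (relIndex_eq_one.1 h2)
  obtain ⟨φ₀, hφ₀, hφ₀m⟩ := key T le_rfl hT
  refine ⟨T, T.map φ₀ ⊔ X, hTX, hT, ?_, ?_⟩
  · rw [relIndex_sup_right]
    exact hfin T hTX φ₀ hφ₀
  intro θ hθ
  -- the finite-index subgroup on which `θ` and `φ₀` vanish modulo `X`
  let S : AddSubgroup G := T ⊓ (X.comap θ ⊓ X.comap φ₀)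
  have hcom : ∀ ψ ∈ L, (X.comap ψ).relIndex X ≠ 0 := by
    intro ψ hψ
    rw [relIndex_comap]
    exact hin ψ hψ
  have hS : S.relIndex X ≠ 0 :=
    relIndex_inf_ne_zero hT (relIndex_inf_ne_zero (hcom θ hθ) (hcom φ₀ hφ₀))
  obtain ⟨φ, hφ, hφm⟩ := key S inf_le_left hS
  have gen : ∀ ψ ∈ L, S ≤ X.comap ψ → T.map ψ ≤ T.map φ ⊔ X := by
    intro ψ hψ hSψ
    have hadd := L.add_mem hφ hψ
    have h1 : T.map (φ + ψ) ≤ S.map φ ⊔ X := by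
      apply eqq
      · rintro _ ⟨s, hs, rfl⟩
        have : φ s = (φ + ψ) s + (-(ψ s)) := by simp
        rw [this]
        exact add_mem_sup ⟨s, hs.1, rfl⟩ (X.neg_mem (hSψ hs))
      · exact hfin T hTX _ hadd
      · exact (hm _ hadd).trans hφm
    rintro _ ⟨t, ht, rfl⟩
    have : ψ t = (φ + ψ) t + φ (-t) := by simp
    rw [this]
    refine add_mem (sup_le_sup_right (AddSubgroup.map_mono inf_le_left) X (h1 ⟨t, ht, rfl⟩)) ?_
    exact le_sup_left (α := AddSubgroup G) ⟨-t, T.neg_mem ht, rfl⟩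
  have g1 := gen θ hθ fun s hs => hs.2.1
  have g2 := gen φ₀ hφ₀ fun s hs => hs.2.2
  have g3 : T.map φ ≤ T.map φ₀ ⊔ X :=
    eqq _ _ g2 (hfin T hTX φ hφ) ((hm φ hφ).trans hφ₀m)
  exact g1.trans (sup_le g3 le_sup_right)

end General

section Finsupp

variable {A : Type*} [AddCommGroup A]

/-- Elements of `A^(ℕ)` supported in `[0, k)`. -/
def lowSub (A : Type*) [AddCommGroup A] (k : ℕ) : AddSubgroup (ℕ →₀ A) where
  carrier := {x | ∀ i, k ≤ i → x i = 0}
  zero_mem' := fun i _ => rfl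
  add_mem' := fun {x y} hx hy i hi => by simp [hx i hi, hy i hi]
  neg_mem' := fun {x} hx i hi => by simp [hx i hi]

lemma lowSub_mono {k l : ℕ} (h : k ≤ l) : lowSub A k ≤ lowSub A l :=
  fun _ hx i hi => hx i (h.trans hi)

lemma exists_mem_lowSub (x : ℕ →₀ A) : ∃ k, x ∈ lowSub A k := by
  obtain ⟨k, hk⟩ := x.support.bddAbove
  refine ⟨k + 1, fun i hi => ?_⟩
  by_contra h0
  have := hk (Finsupp.mem_support_iff.2 h0)
  omega

lemma single_mem_lowSub {k i : ℕ} (h : i < k) (a : A) : Finsupp.single i a ∈ lowSub A k := by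
  intro j hj
  rw [Finsupp.single_apply, if_neg (by omega)]

lemma eq_on_lowSub {B : Type*} [AddCommGroup B] (φ ψ : (ℕ →₀ A) →+ B) (k : ℕ)
    (h : ∀ i < k, ∀ a, φ (Finsupp.single i a) = ψ (Finsupp.single i a)) :
    ∀ x ∈ lowSub A k, φ x = ψ x := by
  intro x hx
  rw [← Finsupp.sum_single x, Finsupp.sum, map_sum, map_sum]
  refine Finset.sum_congr rfl fun i hi => h i ?_ _
  by_contra hik
  exact (Finsupp.mem_support_iff.1 hi) (hx i (by omega))

/-- Finite witnesses: the index of the image of `X` is already attained on the elements of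
bounded support. -/
lemma exists_low_witness (X : AddSubgroup (ℕ →₀ A)) (φ : (ℕ →₀ A) →+ (ℕ →₀ A)) (h : Inr X φ) :
    ∃ k, ∀ l, k ≤ l → X.relIndex (X.map φ) ≤ X.relIndex ((X ⊓ lowSub A l).map φ) := by
  unfold Inr at h
  have : Finite (hatImage X φ) := (finite_hatImage_iff X φ).2 h
  have h1 : ∀ q : hatImage X φ, ∃ x ∈ X, QuotientAddGroup.mk' X (φ x) = q := by
    rintro ⟨_, _, ⟨x, hx, rfl⟩, rfl⟩
    exact ⟨x, hx, rfl⟩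
  choose x hxX hx using h1
  choose k hk using fun q => exists_mem_lowSub (x q)
  obtain ⟨K, hK⟩ := (Set.finite_range k).bddAbove
  refine ⟨K, fun l hl => ?_⟩
  have hle : X.map φ ≤ (X ⊓ lowSub A l).map φ ⊔ X := by
    rintro _ ⟨y, hy, rfl⟩
    let q : hatImage X φ := ⟨QuotientAddGroup.mk' X (φ y), ⟨φ y, ⟨y, hy, rfl⟩, rfl⟩⟩
    have h2 : QuotientAddGroup.mk' X (φ (x q)) = QuotientAddGroup.mk' X (φ y) := hx q
    have h3 : -(φ (x q)) + φ y ∈ X := QuotientAddGroup.eq.1 h2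
    have h4 : φ y = φ (x q) + (-(φ (x q)) + φ y) := by abel
    rw [h4]
    refine add_mem_sup ⟨x q, ⟨hxX q, lowSub_mono ((hK ⟨q, rfl⟩).trans hl) (hk q)⟩, rfl⟩ h3
  have hfin : X.relIndex ((X ⊓ lowSub A l).map φ ⊔ X) ≠ 0 := by
    rw [relIndex_sup_right]
    exact fun h0 => h (relIndex_eq_zero_of_le_right (AddSubgroup.map_mono inf_le_left) h0)
  have := relIndex_le_of_le_right hle hfin
  rwa [relIndex_sup_right] at this

/-- Endomorphisms vanishing on the first `k` coordinates. -/
def killSub (A : Type*) [AddCommGroup A] (k : ℕ) :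
    AddSubgroup ((ℕ →₀ A) →+ (ℕ →₀ A)) where
  carrier := {φ | ∀ x ∈ lowSub A k, φ x = 0}
  zero_mem' := fun _ _ => rfl
  add_mem' := fun {φ ψ} h1 h2 x hx => by simp [h1 x hx, h2 x hx]
  neg_mem' := fun {φ} h1 x hx => by simp [h1 x hx]

/-- The diagonal argument: full inertness is uniform away from finitely many coordinates. -/
lemma exists_uniform (X : AddSubgroup (ℕ →₀ A)) (hX : ∀ φ, Inr X φ) :
    ∃ k N, ∀ φ ∈ killSub A k, X.relIndex (X.map φ) ≤ N := by
  by_contra! hcon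
  have step : ∀ (N : ℕ) (s : ((ℕ →₀ A) →+ (ℕ →₀ A)) × ℕ),
      ∃ t : ((ℕ →₀ A) →+ (ℕ →₀ A)) × ℕ, s.2 < t.2 ∧ (∀ x ∈ lowSub A s.2, t.1 x = s.1 x) ∧
        N < X.relIndex ((X ⊓ lowSub A t.2).map t.1) := by
    rintro N ⟨ψ, k⟩
    obtain ⟨φ, hφ, hbig⟩ := hcon k (N * X.relIndex (X.map (-ψ)))
    obtain ⟨l, hl⟩ := exists_low_witness X (ψ + φ) (hX _)
    refine ⟨(ψ + φ, max (k + 1) l), ?_, ?_, ?_⟩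
    · exact lt_of_lt_of_le (Nat.lt_succ_self k) (le_max_left _ _)
    · intro x hx
      simp [hφ x hx]
    · refine lt_of_lt_of_le ?_ (hl _ (le_max_right _ _))
      have h1 : X.map φ ≤ X.map (ψ + φ) ⊔ X.map (-ψ) := by
        have := map_add_le X (ψ + φ) (-ψ)
        rwa [add_neg_cancel_comm] at this
      obtain ⟨h2, h3⟩ := relIndex_sup_le X _ _ (hX (ψ + φ)) (hX (-ψ))
      have h4 := relIndex_le_of_le_right h1 h2
      by_contra! h5
      have h6 := Nat.mul_le_mul_right (X.relIndex (X.map (-ψ))) h5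
      omega
  choose nxt hn1 hn2 hn3 using step
  let s : ℕ → ((ℕ →₀ A) →+ (ℕ →₀ A)) × ℕ := fun n =>
    Nat.rec (0, 0) (fun n t => nxt n t) n
  have hs : ∀ n, s (n + 1) = nxt n (s n) := fun n => rfl
  have hlt : ∀ n, (s n).2 < (s (n + 1)).2 := fun n => by rw [hs]; exact hn1 _ _
  have hmono : StrictMono fun n => (s n).2 := strictMono_nat_of_lt_succ hlt
  have hagree : ∀ n d, ∀ x ∈ lowSub A (s n).2, (s (n + d)).1 x = (s n).1 x := by
    intro n d
    induction d with
    | zero => intro x _; rfl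
    | succ d ih =>
      intro x hx
      rw [← ih x hx, ← add_assoc, hs]
      exact hn2 _ _ x (lowSub_mono (hmono.monotone (Nat.le_add_right n d)) hx)
  have hagree' : ∀ n m x, x ∈ lowSub A (s n).2 → x ∈ lowSub A (s m).2 →
      (s n).1 x = (s m).1 x := by
    intro n m x h1 h2
    rcases le_total n m with h | h
    · obtain ⟨d, rfl⟩ := Nat.exists_eq_add_of_le h
      exact (hagree n d x h1).symm
    · obtain ⟨d, rfl⟩ := Nat.exists_eq_add_of_le h
      exact hagree m d x h2
  let Φ : (ℕ →₀ A) →+ (ℕ →₀ A) :=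
    Finsupp.liftAddHom fun i => (s (i + 1)).1.comp (Finsupp.singleAddHom i)
  have hΦ : ∀ n, ∀ x ∈ lowSub A (s n).2, Φ x = (s n).1 x := by
    intro n
    apply eq_on_lowSub
    intro i hi a
    have h1 : Φ (Finsupp.single i a) = (s (i + 1)).1 (Finsupp.single i a) := by
      simp [Φ]
    rw [h1]
    refine hagree' (i + 1) n _ (single_mem_lowSub ?_ a) (single_mem_lowSub hi a)
    exact lt_of_lt_of_le (Nat.lt_succ_self i) (hmono.le_apply (x := i + 1))
  have hbig : ∀ n, n < X.relIndex (X.map Φ) := by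
    intro n
    refine lt_of_lt_of_le (hn3 n (s n)) ?_
    rw [← hs]
    refine relIndex_le_of_le_right ?_ (hX Φ)
    rintro _ ⟨x, hx, rfl⟩
    exact ⟨x, hx.1, hΦ (n + 1) x hx.2⟩
  exact lt_irrefl _ (hbig _)

lemma minFull_finsupp : MinFullInertia (ℕ →₀ A) := by
  intro X hX
  rw [fullyInert_iff] at hX
  obtain ⟨k, N, hN⟩ := exists_uniform X hX
  obtain ⟨T, V, hTX, hT, hV, hLT⟩ := exists_core X (killSub A k) N (fun φ _ => hX φ) hN
  -- the shifts
  have hinj : Function.Injective fun n : ℕ => n + k := add_left_injective k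
  let σ : (ℕ →₀ A) →+ (ℕ →₀ A) := Finsupp.mapDomain.addMonoidHom fun n : ℕ => n + k
  let τ : (ℕ →₀ A) →+ (ℕ →₀ A) := Finsupp.comapDomain.addMonoidHom hinj
  have hτσ : ∀ x, τ (σ x) = x := fun x => Finsupp.comapDomain_mapDomain _ hinj x
  have hτ : τ ∈ killSub A k := by
    intro x hx
    ext n
    exact hx (n + k) (Nat.le_add_left k n)
  let Y : AddSubgroup (ℕ →₀ A) := ⨆ φ : killSub A k, T.map φ.1
  have hTY : ∀ φ ∈ killSub A k, T.map φ ≤ Y := fun φ hφ =>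
    le_iSup (fun φ : killSub A k => T.map φ.1) ⟨φ, hφ⟩
  refine ⟨Y, ?_, ?_⟩
  · intro φ
    rw [AddSubgroup.map_iSup]
    refine iSup_le fun ψ => ?_
    rw [AddSubgroup.map_map]
    refine hTY _ fun x hx => ?_
    simp [ψ.2 x hx]
  · rw [commens_iff]
    constructor
    · -- `τ T ≤ Y` and `τ T` has finite index in `τ X`, in which `X` is almost contained
      have h1 : (T.map τ).relIndex (X.map τ) ≠ 0 := relIndex_map_ne_zero τ hT
      have h2 : (X.map τ).relIndex X ≠ 0 := by
        have h3 := relIndex_map_ne_zero τ (hX σ)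
        have h4 : (X.map σ).map τ = X := by
          have h5 : τ.comp σ = AddMonoidHom.id _ := AddMonoidHom.ext hτσ
          rw [AddSubgroup.map_map, h5, AddSubgroup.map_id]
        rwa [h4] at h3
      intro h0
      exact relIndex_ne_zero_trans h1 h2 (relIndex_eq_zero_of_le_left (hTY τ hτ) h0)
    · have hYV : Y ≤ V := iSup_le fun φ => hLT φ.1 φ.2
      exact fun h0 => hV (relIndex_eq_zero_of_le_right hYV h0)

end Finsupp

section Separable

variable {G : Type*} [AddCommGroup G]

lemma mem_pPowSub {p n : ℕ} {x : G} : x ∈ (pPowSub p n : AddSubgroup G) ↔ ∃ y, p ^ n • y = x := by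
  constructor
  · rintro ⟨y, _, rfl⟩
    exact ⟨y, rfl⟩
  · rintro ⟨y, rfl⟩
    exact ⟨y, trivial, rfl⟩

lemma separable_iff {p : ℕ} :
    SeparableP p G ↔ ∀ x : G, (∀ n, ∃ y, p ^ n • y = x) → x = 0 := by
  unfold SeparableP
  rw [AddSubgroup.eq_bot_iff_forall]
  simp only [AddSubgroup.mem_iInf, mem_pPowSub]

end Separable

end Aux

universe u

/-- Corollary 2.15: every separable `p`-group `A` is a direct summand of a separable `p`-group
`G = A ⊕ K` having both minimal characteristic inertia and minimal full inertia. -/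
theorem stmt_14 {A : Type u} [AddCommGroup A] (p : ℕ) (hp : p.Prime)
    (hA : IsPGroup' p A) (hsep : SeparableP p A) :
    ∃ (K : Type u) (_ : AddCommGroup K), IsPGroup' p K ∧ SeparableP p K ∧
      SeparableP p (A × K) ∧ MinCharInertia (A × K) ∧ MinFullInertia (A × K) := by
  rw [separable_iff] at hsep
  have hK : SeparableP p (ℕ →₀ A) := by
    rw [separable_iff]
    intro x hx
    ext i
    refine hsep _ fun n => ?_
    obtain ⟨y, rfl⟩ := hx n
    exact ⟨y i, rfl⟩
  -- `A ⊕ A^(ℕ) ≅ A^(ℕ) ≅ A^(ℕ) ⊕ A^(ℕ)`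
  let e₁ : (A × (ℕ →₀ A)) ≃+ (ℕ →₀ A) :=
    ((AddEquiv.prodCongr (Finsupp.uniqueAddEquiv (M := A) ()).symm (AddEquiv.refl _)).trans
      Finsupp.sumFinsuppAddEquivProdFinsupp.symm).trans
      (Finsupp.domCongr ((Equiv.sumComm Unit ℕ).trans Equiv.natSumPUnitEquivNat))
  let e₂ : (ℕ →₀ A) ≃+ (ℕ →₀ A) × (ℕ →₀ A) :=
    (Finsupp.domCongr (Denumerable.eqv (ℕ ⊕ ℕ)).symm).trans
      Finsupp.sumFinsuppAddEquivProdFinsupp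
  have hfull : MinFullInertia (A × (ℕ →₀ A)) := minFull_transport e₁ minFull_finsupp
  refine ⟨ℕ →₀ A, inferInstance, ?_, hK, ?_, minChar_of_minFull (e₁.trans e₂) hfull, hfull⟩
  · intro x
    induction x using Finsupp.induction_linear with
    | zero => exact ⟨0, by simp⟩
    | add x y hx hy =>
      obtain ⟨n, hn⟩ := hx
      obtain ⟨m, hm⟩ := hy
      refine ⟨n + m, ?_⟩
      rw [smul_add, pow_add, mul_smul, mul_smul, hm, smul_comm, hn]
      simp
    | single i a =>
      obtain ⟨n, hn⟩ := hA a
      exact ⟨n, by rw [Finsupp.smul_single, hn, Finsupp.single_zero]⟩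
  · rw [separable_iff] at hK ⊢
    intro x hx
    refine Prod.ext (hsep _ fun n => ?_) (hK _ fun n => ?_)
    · obtain ⟨y, rfl⟩ := hx n
      exact ⟨y.1, rfl⟩
    · obtain ⟨y, rfl⟩ := hx n
      exact ⟨y.2, rfl⟩
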